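/- arXiv:2503.14058 — 2 statements merged into one kernel-verified Lean document; each statement's English description precedes it below -/
import Mathlib

section
/- Let q be an odd prime power. The number of hyperbolic quadrics in PG(3,q) is (1/2) q^4 (q^2+1)(q^3-1). -/
open Matrix

namespace HypQuad

abbrev I4 := Fin 2 ⊕ Fin 2

/-- generic counting by fibres of constant size -/
lemma card_fib {α β : Type*} [Finite α] (f : α → β) (k : ℕ)
    (h : ∀ a, Nat.card {x // f x = f a} = k) :
    Nat.card α = (Set.range f).ncard * k := by
  classical
  have e : α ≃ Σ b : Set.range f, {x // f x = b.1} :=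
    { toFun := fun a => ⟨⟨f a, a, rfl⟩, ⟨a, rfl⟩⟩
      invFun := fun p => p.2.1
      left_inv := fun a => rfl
      right_inv := by
        rintro ⟨⟨b, hb⟩, ⟨x, hx⟩⟩
        dsimp at hx
        subst hx
        rfl }
  have : Fintype (Set.range f) := Fintype.ofFinite _
  rw [Nat.card_congr e, Nat.card_sigma]
  have : ∀ b : Set.range f, Nat.card {x // f x = b.1} = k := by
    rintro ⟨_, a, rfl⟩
    exact h a
  simp only [this, Finset.sum_const, Finset.card_univ, smul_eq_mul]
  rw [← Nat.card_eq_fintype_card, Nat.card_coe_set_eq]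

variable {F : Type} [Field F]

/-- the standard form -/
abbrev J (F : Type) [Field F] : Matrix I4 I4 F := Matrix.fromBlocks 0 1 1 0

def s (v : I4 → F) : F := v (.inl 0) * v (.inr 0) + v (.inl 1) * v (.inr 1)

lemma form_eq (Q : Matrix I4 I4 F) (v : I4 → F) :
    v ⬝ᵥ (Q * J F * Qᵀ).mulVec v = 2 * s (v ᵥ* Q) := by
  have : v ⬝ᵥ (Q * J F * Qᵀ).mulVec v = (v ᵥ* Q) ⬝ᵥ (J F).mulVec (v ᵥ* Q) := by
    rw [← Matrix.mulVec_mulVec, Matrix.mulVec_transpose, ← Matrix.mulVec_mulVec,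
      Matrix.dotProduct_mulVec]
  rw [this]
  generalize v ᵥ* Q = w
  simp [s, dotProduct, mulVec, Fintype.sum_sum_type, Fin.sum_univ_two, Matrix.one_apply]
  ring

def IsGO (M : Matrix I4 I4 F) : Prop := ∃ c : F, c ≠ 0 ∧ M * J F * Mᵀ = c • J F

lemma bil (M : Matrix I4 I4 F) (i j : I4) : (M * J F * Mᵀ) i j =
    M i (.inl 0) * M j (.inr 0) + M i (.inl 1) * M j (.inr 1) + M i (.inr 0) * M j (.inl 0)
     + M i (.inr 1) * M j (.inl 1) := by
  simp [Matrix.mul_apply, Fintype.sum_sum_type, Fin.sum_univ_two, Matrix.one_apply]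
  ring

lemma isGO_mul {M N : Matrix I4 I4 F} (hM : IsGO M) (hN : IsGO N) : IsGO (M * N) := by
  obtain ⟨c, hc, h⟩ := hM
  obtain ⟨d, hd, h'⟩ := hN
  refine ⟨d * c, mul_ne_zero hd hc, ?_⟩
  have : M * N * J F * (M * N)ᵀ = M * (N * J F * Nᵀ) * Mᵀ := by
    simp [Matrix.mul_assoc]
  rw [this, h', Matrix.mul_smul, Matrix.smul_mul, h, smul_smul]

lemma JJ : J F * J F = 1 := by
  simp [J, Matrix.fromBlocks_multiply]

lemma isGO_inv {M : Matrix I4 I4 F} (hM : IsGO M) : ∃ N, IsGO N ∧ M * N = 1 ∧ N * M = 1 := by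
  obtain ⟨c, hc, h⟩ := hM
  have h1 : M * (c⁻¹ • (J F * Mᵀ * J F)) = 1 := by
    rw [Matrix.mul_smul, ← Matrix.mul_assoc, ← Matrix.mul_assoc, h, Matrix.smul_mul, JJ, smul_smul,
      inv_mul_cancel₀ hc, one_smul]
  set N := c⁻¹ • (J F * Mᵀ * J F) with hN
  have h2 : N * M = 1 := mul_eq_one_comm.mp h1
  refine ⟨N, ⟨c⁻¹, inv_ne_zero hc, ?_⟩, h1, h2⟩
  have h3 : Mᵀ * Nᵀ = 1 := by rw [← Matrix.transpose_mul, h2, Matrix.transpose_one]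
  calc N * J F * Nᵀ = c⁻¹ • (N * (c • J F) * Nᵀ) := by
        rw [Matrix.mul_smul N c, Matrix.smul_mul c, smul_smul, inv_mul_cancel₀ hc, one_smul]
    _ = c⁻¹ • ((N * M) * J F * (Mᵀ * Nᵀ)) := by rw [← h]; simp only [Matrix.mul_assoc]
    _ = _ := by rw [h2, h3]; simp

lemma isGO_iff (h2 : (2 : F) ≠ 0) (M : Matrix I4 I4 F) (hM : IsUnit M) :
    IsGO M ↔ ∀ v, s (v ᵥ* M) = 0 ↔ s v = 0 := by
  have hs : ∀ v, s (v ᵥ* M) = 0 ↔ v ⬝ᵥ (M * J F * Mᵀ).mulVec v = 0 := by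
    intro v; rw [form_eq]; simp [h2]
  have hs' : ∀ v : I4 → F, s v = 0 ↔ v ⬝ᵥ (J F).mulVec v = 0 := by
    intro v
    have := form_eq (1 : Matrix I4 I4 F) v
    simp at this
    rw [this]; simp [h2]
  constructor
  · rintro ⟨c, hc, h⟩ v
    rw [hs, hs', h, Matrix.smul_mulVec, dotProduct_smul]
    simp [hc]
  · intro h
    have hsym : (M * J F * Mᵀ)ᵀ = M * J F * Mᵀ := by
      simp [Matrix.mul_assoc, J, Matrix.fromBlocks_transpose]
    have hu : IsUnit (M * J F * Mᵀ) := by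
      refine (hM.mul (IsUnit.of_mul_eq_one _ JJ)).mul ?_
      exact (Matrix.isUnit_transpose M).mpr hM
    have key : ∀ v : I4 → F, s v = 0 → v ⬝ᵥ (M * J F * Mᵀ).mulVec v = 0 :=
      fun v hv => (hs v).mp ((h v).mpr hv)
    unfold IsGO
    generalize M * J F * Mᵀ = H at *
    have sy : ∀ i j, H i j = H j i := fun i j => by
      conv_lhs => rw [← hsym]
      rfl
    have key' : ∀ a b c d : F, a * c + b * d = 0 →
        a*a*H (.inl 0) (.inl 0) + b*b*H (.inl 1) (.inl 1) + c*c*H (.inr 0) (.inr 0)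
        + d*d*H (.inr 1) (.inr 1) + 2 * (a*b*H (.inl 0) (.inl 1) + a*c*H (.inl 0) (.inr 0)
        + a*d*H (.inl 0) (.inr 1) + b*c*H (.inl 1) (.inr 0) + b*d*H (.inl 1) (.inr 1)
        + c*d*H (.inr 0) (.inr 1)) = 0 := by
      intro a b c d habcd
      have := key (Sum.elim ![a, b] ![c, d]) (by simpa [s] using habcd)
      simp [dotProduct, mulVec, Fintype.sum_sum_type, Fin.sum_univ_two] at this
      rw [sy (.inl 1) (.inl 0), sy (.inr 0) (.inl 0), sy (.inr 0) (.inl 1), sy (.inr 1) (.inl 0),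
        sy (.inr 1) (.inl 1), sy (.inr 1) (.inr 0)] at this
      linear_combination this
    have k0 := key' 1 0 0 0 (by ring)
    have k1 := key' 0 1 0 0 (by ring)
    have k2 := key' 0 0 1 0 (by ring)
    have k3 := key' 0 0 0 1 (by ring)
    have k01 := key' 1 1 0 0 (by ring)
    have k03 := key' 1 0 0 1 (by ring)
    have k12 := key' 0 1 1 0 (by ring)
    have k23 := key' 0 0 1 1 (by ring)
    have kk := key' 1 1 1 (-1) (by ring)
    simp at k0 k1 k2 k3
    simp [k0, k1, k2, k3, h2] at k01 k03 k12 k23 kk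
    simp [k01, k03, k12, k23] at kk
    have kk' : H (.inl 1) (.inr 1) = H (.inl 0) (.inr 0) := by linear_combination -kk
    have hH : H = H (.inl 0) (.inr 0) • J F := by
      ext i j
      rcases i with i | i <;> rcases j with j | j <;> fin_cases i <;> fin_cases j <;>
        simp [k0, k1, k2, k3, k01, k03, k12, k23, kk', sy (.inl 1) (.inl 0), sy (.inr 0) (.inl 0),
          sy (.inr 0) (.inl 1), sy (.inr 1) (.inl 0), sy (.inr 1) (.inl 1), sy (.inr 1) (.inr 0)]
    refine ⟨_, ?_, hH⟩
    intro h0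
    rw [h0, zero_smul] at hH
    rw [hH] at hu
    exact not_isUnit_zero hu

/-- explicit matrix by rows -/
def mk (a b c d : Fin 4 → F) : Matrix I4 I4 F :=
  let r : (Fin 4 → F) → I4 → F := fun v => Sum.elim ![v 0, v 1] ![v 2, v 3]
  Matrix.of (Sum.elim ![r a, r b] ![r c, r d])

lemma isGO_of (M : Matrix I4 I4 F) (c : F) (hc : c ≠ 0)
    (h : ∀ i j, (M * J F * Mᵀ) i j = (c • J F) i j) : IsGO M :=
  ⟨c, hc, by ext i j; exact h i j⟩

lemma trans (v : I4 → F) (hv : v ≠ 0) (hs : s v = 0) :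
    ∃ M : Matrix I4 I4 F, IsGO M ∧ M (.inl 0) = v := by
  obtain ⟨a, b, c, d, rfl⟩ : ∃ a b c d : F, v = Sum.elim ![a, b] ![c, d] := by
    refine ⟨v (.inl 0), v (.inl 1), v (.inr 0), v (.inr 1), ?_⟩
    ext i
    rcases i with i | i <;> fin_cases i <;> rfl
  simp only [s, Sum.elim_inl, Sum.elim_inr, Matrix.cons_val_zero, Matrix.cons_val_one] at hs
  by_cases ha : a ≠ 0
  · refine ⟨mk ![a,b,c,d] ![0,1,-d/a,0] ![0,0,1/a,0] ![0,0,-b/a,1],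
      isGO_of _ 1 one_ne_zero ?_, rfl⟩
    intro i j
    rw [bil]
    rcases i with i | i <;> rcases j with j | j <;> fin_cases i <;> fin_cases j <;>
      simp [mk] <;> field_simp <;> grind
  by_cases hb : b ≠ 0
  · refine ⟨mk ![a,b,c,d] ![1,0,0,-c/b] ![0,0,0,1/b] ![0,0,1,-a/b],
      isGO_of _ 1 one_ne_zero ?_, rfl⟩
    intro i j
    rw [bil]
    rcases i with i | i <;> rcases j with j | j <;> fin_cases i <;> fin_cases j <;>
      simp [mk] <;> field_simp <;> grind
  by_cases hc : c ≠ 0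
  · refine ⟨mk ![a,b,c,d] ![-d/c,1,0,0] ![1/c,0,0,0] ![-b/c,0,0,1],
      isGO_of _ 1 one_ne_zero ?_, rfl⟩
    intro i j
    rw [bil]
    rcases i with i | i <;> rcases j with j | j <;> fin_cases i <;> fin_cases j <;>
      simp [mk] <;> field_simp <;> grind
  by_cases hd : d ≠ 0
  · refine ⟨mk ![a,b,c,d] ![0,-c/d,1,0] ![0,1/d,0,0] ![1,-a/d,0,0],
      isGO_of _ 1 one_ne_zero ?_, rfl⟩
    intro i j
    rw [bil]
    rcases i with i | i <;> rcases j with j | j <;> fin_cases i <;> fin_cases j <;>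
      simp [mk] <;> field_simp <;> grind
  exfalso
  push Not at ha hb hc hd
  subst ha hb hc hd
  apply hv
  ext i
  rcases i with i | i <;> fin_cases i <;> rfl

/-- the four kinds of nonzero singular vectors -/
def vecMap : Fˣ × ((F × F) ⊕ (F ⊕ (F ⊕ Unit))) → (I4 → F)
  | (t, .inl (x, y)) => Sum.elim ![t, x] ![-x * y / t, y]
  | (t, .inr (.inl x)) => Sum.elim ![0, t] ![x, 0]
  | (t, .inr (.inr (.inl x))) => Sum.elim ![0, 0] ![t, x]
  | (t, .inr (.inr (.inr _))) => Sum.elim ![0, 0] ![0, t]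

lemma elim_inj {a b c d a' b' c' d' : F}
    (h : (Sum.elim ![a, b] ![c, d] : I4 → F) = Sum.elim ![a', b'] ![c', d']) :
    a = a' ∧ b = b' ∧ c = c' ∧ d = d' :=
  ⟨congrFun h (.inl 0), congrFun h (.inl 1), congrFun h (.inr 0), congrFun h (.inr 1)⟩

lemma vecMap_inj : Function.Injective (vecMap (F := F)) := by
  rintro ⟨t, (⟨x, y⟩ | x | x | x)⟩ ⟨t', (⟨x', y'⟩ | x' | x' | x')⟩ h <;>
    have h' := elim_inj h <;> simp at h' <;>
    first
    | exact absurd h'.1.symm t'.ne_zero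
    | simp [h', Units.ext_iff]

lemma vecMap_range : Set.range (vecMap (F := F)) = {v | v ≠ 0 ∧ s v = 0} := by
  ext v
  constructor
  · rintro ⟨⟨t, (⟨x, y⟩ | x | x | x)⟩, rfl⟩
    · refine ⟨fun h => t.ne_zero (congrFun h (.inl 0)), ?_⟩
      have := t.ne_zero
      simp [vecMap, s]
      field_simp
      ring
    · exact ⟨fun h => t.ne_zero (congrFun h (.inl 1)), by simp [vecMap, s]⟩
    · exact ⟨fun h => t.ne_zero (congrFun h (.inr 0)), by simp [vecMap, s]⟩
    · exact ⟨fun h => t.ne_zero (congrFun h (.inr 1)), by simp [vecMap, s]⟩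
  · rintro ⟨hv, hs⟩
    obtain ⟨a, b, c, d, rfl⟩ : ∃ a b c d : F, v = Sum.elim ![a, b] ![c, d] := by
      refine ⟨v (.inl 0), v (.inl 1), v (.inr 0), v (.inr 1), ?_⟩
      ext i
      rcases i with i | i <;> fin_cases i <;> rfl
    simp only [s, Sum.elim_inl, Sum.elim_inr, Matrix.cons_val_zero, Matrix.cons_val_one] at hs
    by_cases ha : a ≠ 0
    · refine ⟨(Units.mk0 a ha, .inl (b, d)), ?_⟩
      have : -b * d / a = c := by field_simp; linear_combination -hs
      simp only [vecMap, Units.val_mk0, this]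
    push Not at ha
    subst ha
    by_cases hb : b ≠ 0
    · refine ⟨(Units.mk0 b hb, .inr (.inl c)), ?_⟩
      have : d = 0 := by simpa [hb] using hs
      simp only [vecMap, Units.val_mk0, this]
    push Not at hb
    subst hb
    by_cases hc : c ≠ 0
    · exact ⟨(Units.mk0 c hc, .inr (.inr (.inl d))), rfl⟩
    push Not at hc
    subst hc
    by_cases hd : d ≠ 0
    · exact ⟨(Units.mk0 d hd, .inr (.inr (.inr ()))), rfl⟩
    exfalso
    push Not at hd
    subst hd
    apply hv
    ext i
    rcases i with i | i <;> fin_cases i <;> rfl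

/-- the first basis vector -/
def e0 : I4 → F := Sum.elim ![1, 0] ![0, 0]

def stabMap : F × F × Fˣ × Fˣ × Bool → Matrix I4 I4 F
  | (x, y, l, t, true) => mk ![1,0,0,0] ![-t*y/l,t,0,0] ![-x*y/l,x,l,y] ![-x/t,0,0,l/t]
  | (x, y, l, t, false) => mk ![1,0,0,0] ![-t*x/l,0,0,t] ![-x*y/l,x,l,y] ![-y/t,l/t,0,0]

lemma stabMap_inj : Function.Injective (stabMap (F := F)) := by
  rintro ⟨x, y, l, t, b⟩ ⟨x', y', l', t', b'⟩ h
  have h1 := congrFun (congrFun h (.inr 0)) (.inl 1)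
  have h2 := congrFun (congrFun h (.inr 0)) (.inr 0)
  have h3 := congrFun (congrFun h (.inr 0)) (.inr 1)
  have h4 := congrFun (congrFun h (.inl 1)) (.inl 1)
  have h5 := congrFun (congrFun h (.inl 1)) (.inr 1)
  cases b <;> cases b' <;> simp [stabMap, mk] at h1 h2 h3 h4 h5 <;>
    simp [Units.ext_iff, *]

lemma stabMap_range (h2 : (2 : F) ≠ 0) :
    Set.range (stabMap (F := F)) = {M | IsGO M ∧ M (.inl 0) = e0} := by
  ext M
  constructor
  · rintro ⟨⟨x, y, l, t, b⟩, rfl⟩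
    have hl := l.ne_zero
    have ht := t.ne_zero
    cases b
    all_goals
      refine ⟨isGO_of _ l hl ?_, rfl⟩
      intro i j
      rw [bil]
      rcases i with i | i <;> rcases j with j | j <;> fin_cases i <;> fin_cases j <;>
        simp [stabMap, mk] <;> field_simp <;> ring
  · rintro ⟨⟨l, hl, h⟩, hM⟩
    have g : ∀ i j, _ := fun i j => (bil M i j).symm.trans (congrFun (congrFun h i) j)
    have m0 : M (.inl 0) (.inl 0) = 1 := by rw [hM]; rfl
    have m1 : M (.inl 0) (.inl 1) = 0 := by rw [hM]; rfl
    have m2 : M (.inl 0) (.inr 0) = 0 := by rw [hM]; rfl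
    have m3 : M (.inl 0) (.inr 1) = 0 := by rw [hM]; rfl
    have g1 := g (.inl 0) (.inl 1)
    have g2 := g (.inl 0) (.inr 0)
    have g3 := g (.inl 0) (.inr 1)
    have g4 := g (.inl 1) (.inl 1)
    have g5 := g (.inl 1) (.inr 0)
    have g6 := g (.inl 1) (.inr 1)
    have g7 := g (.inr 0) (.inr 0)
    have g8 := g (.inr 0) (.inr 1)
    have g9 := g (.inr 1) (.inr 1)
    simp [m0, m1, m2, m3] at g1 g2 g3
    simp [g1, g2, g3] at g4 g5 g6 g7 g8 g9
    have g4' : M (.inl 1) (.inl 1) * M (.inl 1) (.inr 1) = 0 :=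
      (mul_eq_zero.mp (show (2 : F) * _ = 0 by linear_combination g4)).resolve_left h2
    have g9' : M (.inr 1) (.inl 1) * M (.inr 1) (.inr 1) = 0 :=
      (mul_eq_zero.mp (show (2 : F) * _ = 0 by linear_combination g9)).resolve_left h2
    have g7' : M (.inr 0) (.inl 0) * l + M (.inr 0) (.inl 1) * M (.inr 0) (.inr 1) = 0 :=
      (mul_eq_zero.mp (show (2 : F) * _ = 0 by linear_combination g7)).resolve_left h2
    by_cases hb : M (.inl 1) (.inl 1) = 0
    · simp [hb] at g5 g6
      have hc : M (.inl 1) (.inr 1) ≠ 0 := by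
        rintro h0; rw [h0, zero_mul] at g6; exact hl g6.symm
      have hd : M (.inr 1) (.inl 1) ≠ 0 := by
        rintro h0; rw [h0, mul_zero] at g6; exact hl g6.symm
      have hd' : M (.inr 1) (.inr 1) = 0 := by simpa [hd] using g9'
      refine ⟨(M (.inr 0) (.inl 1), M (.inr 0) (.inr 1), Units.mk0 l hl, Units.mk0 _ hc, false), ?_⟩
      ext i j
      rcases i with i | i <;> rcases j with j | j <;> fin_cases i <;> fin_cases j <;>
        simp [stabMap, mk, m0, m1, m2, m3, g1, g2, g3, hb, hd'] <;> field_simp <;> grind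
    · have hc : M (.inl 1) (.inr 1) = 0 := by simpa [hb] using g4'
      simp [hc] at g5 g6
      have hd : M (.inr 1) (.inr 1) ≠ 0 := by
        rintro h0; rw [h0, mul_zero] at g6; exact hl g6.symm
      have hd' : M (.inr 1) (.inl 1) = 0 := by simpa [hd] using g9'
      refine ⟨(M (.inr 0) (.inl 1), M (.inr 0) (.inr 1), Units.mk0 l hl, Units.mk0 _ hb, true), ?_⟩
      ext i j
      rcases i with i | i <;> rcases j with j | j <;> fin_cases i <;> fin_cases j <;>
        simp [stabMap, mk, m0, m1, m2, m3, g1, g2, g3, hc, hd'] <;> field_simp <;> grind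

lemma row_mul (M N : Matrix I4 I4 F) (i : I4) : (M * N) i = M i ᵥ* N := by
  ext j; rfl

lemma e0_vecMul (N : Matrix I4 I4 F) : e0 ᵥ* N = N (.inl 0) := by
  ext j
  simp [e0, vecMul, dotProduct, Fintype.sum_sum_type, Fin.sum_univ_two]

lemma card_GO [Fintype F] (h2 : (2 : F) ≠ 0) (q : ℕ) (hq : Fintype.card F = q) :
    Nat.card {M : Matrix I4 I4 F // IsGO M} =
      ((q - 1) * (q ^ 2 + 2 * q + 1)) * (2 * q ^ 2 * (q - 1) ^ 2) := by
  classical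
  have hu : Nat.card Fˣ = q - 1 := by
    rw [Nat.card_eq_fintype_card, Fintype.card_units, hq]
  have hF : Nat.card F = q := by rw [Nat.card_eq_fintype_card, hq]
  have hrange : Set.range (fun M : {M : Matrix I4 I4 F // IsGO M} => M.1 (.inl 0)) =
      {v | v ≠ 0 ∧ s v = 0} := by
    ext v
    constructor
    · rintro ⟨⟨M, c, hc, h⟩, rfl⟩
      have h1 := (bil M (.inl 0) (.inl 0)).symm.trans (congrFun (congrFun h _) _)
      have h3 := (bil M (.inl 0) (.inr 0)).symm.trans (congrFun (congrFun h _) _)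
      refine ⟨fun h0 => ?_, ?_⟩
      · dsimp only at h0
        simp [h0] at h3
        exact hc h3.symm
      · simp at h1
        exact (mul_eq_zero.mp (show (2 : F) * _ = 0 by
          simp only [s]; linear_combination h1)).resolve_left h2
    · rintro ⟨hv, hs⟩
      obtain ⟨M, hM, h⟩ := trans v hv hs
      exact ⟨⟨M, hM⟩, h⟩
  rw [card_fib (fun M : {M : Matrix I4 I4 F // IsGO M} => M.1 (.inl 0))
    (2 * q ^ 2 * (q - 1) ^ 2), hrange, ← vecMap_range, ← Set.image_univ,
    Set.ncard_image_of_injective _ vecMap_inj, Set.ncard_univ]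
  · congr 1
    simp [Nat.card_prod, Nat.card_sum, hF, -Nat.card_eq_fintype_card, hu]
    left; ring
  · rintro ⟨M, hM⟩
    obtain ⟨N, hN, hMN, hNM⟩ := isGO_inv hM
    have : Nat.card {M : Matrix I4 I4 F // IsGO M ∧ M (.inl 0) = e0} =
        2 * q ^ 2 * (q - 1) ^ 2 := by
      change Nat.card ({M : Matrix I4 I4 F | IsGO M ∧ M (.inl 0) = e0} : Set _) = _
      rw [Nat.card_coe_set_eq, ← stabMap_range h2, ← Set.image_univ,
        Set.ncard_image_of_injective _ stabMap_inj, Set.ncard_univ]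
      have hB : Nat.card Bool = 2 := by simp
      simp [Nat.card_prod, hF, -Nat.card_eq_fintype_card, hu, hB]
      ring
    rw [← this]
    refine Nat.card_congr
      { toFun := fun X => ⟨X.1.1 * N, isGO_mul X.1.2 hN, ?_⟩
        invFun := fun X => ⟨⟨X.1 * M, isGO_mul X.2.1 hM⟩, ?_⟩
        left_inv := fun X => ?_
        right_inv := fun X => ?_ }
    · have h1 : X.1.1 (.inl 0) = M (.inl 0) := X.2
      rw [row_mul, h1, ← row_mul, hMN]
      exact (e0_vecMul 1).symm.trans (Matrix.vecMul_one _)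
    · change (X.1 * M) (.inl 0) = M (.inl 0)
      rw [row_mul, X.2.2, e0_vecMul]
    · apply Subtype.ext; apply Subtype.ext
      change X.1.1 * N * M = _
      rw [Matrix.mul_assoc, hNM, Matrix.mul_one]
    · apply Subtype.ext
      change X.1 * M * N = _
      rw [Matrix.mul_assoc, hMN, Matrix.mul_one]

/-- projective zero set -/
def zs (Q : GL I4 F) : Set (Projectivization F (I4 → F)) :=
  {P | P.rep ⬝ᵥ (Q.1 * J F * Q.1ᵀ).mulVec P.rep = 0}

lemma s_smul (c : F) (v : I4 → F) : s (c • v) = c ^ 2 * s v := by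
  simp [s]; ring

lemma zs_eq_iff (h2 : (2 : F) ≠ 0) (Q R : GL I4 F) :
    zs Q = zs R ↔ ∀ v, s (v ᵥ* Q.1) = 0 ↔ s (v ᵥ* R.1) = 0 := by
  simp only [zs, form_eq, Set.ext_iff, Set.mem_ofPred_eq, mul_eq_zero, h2, false_or]
  constructor
  · intro h v
    by_cases hv : v = 0
    · simp [hv, s]
    have h1 := h (Projectivization.mk F v hv)
    obtain ⟨a, ha⟩ := Projectivization.exists_smul_eq_mk_rep F v hv
    rw [← ha, Units.smul_def, Matrix.smul_vecMul, Matrix.smul_vecMul, s_smul, s_smul] at h1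
    simpa using h1
  · intro h P
    exact h _

lemma zs_fib (h2 : (2 : F) ≠ 0) (R : GL I4 F) :
    Nat.card {Q : GL I4 F // zs Q = zs R} = Nat.card {M : Matrix I4 I4 F // IsGO M} := by
  have key : ∀ Q : GL I4 F, zs Q = zs R ↔ IsGO (R⁻¹ * Q).1 := by
    intro Q
    rw [zs_eq_iff h2, isGO_iff h2 _ (R⁻¹ * Q).isUnit]
    constructor
    · intro h v
      have := h (v ᵥ* (R⁻¹).1)
      rw [Matrix.vecMul_vecMul, Matrix.vecMul_vecMul, ← Units.val_mul, ← Units.val_mul] at this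
      simpa using this
    · intro h v
      have := h (v ᵥ* R.1)
      rw [Matrix.vecMul_vecMul, ← Units.val_mul] at this
      simpa using this
  refine Nat.card_eq_of_bijective (fun Q => ⟨(R⁻¹ * Q.1).1, (key _).mp Q.2⟩) ⟨?_, ?_⟩
  · intro X Y h
    have h1 : (R⁻¹ * X.1).1 = (R⁻¹ * Y.1).1 := congrArg Subtype.val h
    exact Subtype.ext (mul_left_cancel (Units.ext h1))
  · rintro ⟨M, hM⟩
    obtain ⟨N, hN, hMN, hNM⟩ := isGO_inv hM
    let U : GL I4 F := ⟨M, N, hMN, hNM⟩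
    have hU : R⁻¹ * (R * U) = U := by group
    refine ⟨⟨R * U, (key _).mpr (by rw [hU]; exact hM)⟩, ?_⟩
    apply Subtype.ext
    change (R⁻¹ * (R * U)).1 = M
    rw [hU]

lemma card_GL4 [Fintype F] (q : ℕ) (hq : Fintype.card F = q) :
    Nat.card (GL I4 F) = (q^4-1)*(q^4-q)*(q^4-q^2)*(q^4-q^3) := by
  have e : GL I4 F ≃* GL (Fin 4) F :=
    Units.mapEquiv (Matrix.reindexRingEquiv F (finSumFinEquiv : Fin 2 ⊕ Fin 2 ≃ Fin 4)).toMulEquiv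
  rw [Nat.card_congr e.toEquiv, Matrix.card_GL_field]
  simp [Fin.prod_univ_succ, hq]
  ring

end HypQuad

open HypQuad in
/-- The number of hyperbolic quadrics in PG(3,q) (zero sets of symmetric matrices
cogredient to [[0,I₂],[I₂,0]], as subsets of projective space) is ½q⁴(q²+1)(q³-1). -/
theorem stmt_5 (F : Type) [Field F] [Fintype F] (q : ℕ) (hq : Fintype.card F = q)
    (hodd : Odd q) :
    2 * {Z : Set (Projectivization F ((Fin 2 ⊕ Fin 2) → F)) |
      ∃ H : Matrix (Fin 2 ⊕ Fin 2) (Fin 2 ⊕ Fin 2) F,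
        (∃ Q : Matrix (Fin 2 ⊕ Fin 2) (Fin 2 ⊕ Fin 2) F, IsUnit Q.det ∧
          H = Q * Matrix.fromBlocks 0 1 1 0 * Qᵀ) ∧
        Z = {P : Projectivization F ((Fin 2 ⊕ Fin 2) → F) |
          P.rep ⬝ᵥ H.mulVec P.rep = 0}}.ncard
      = q ^ 4 * (q ^ 2 + 1) * (q ^ 3 - 1) := by
  have h2 : (2 : F) ≠ 0 := by
    apply Ring.two_ne_zero
    intro h
    have := FiniteField.even_card_iff_char_two.mp h
    rw [hq] at this
    rcases hodd with ⟨k, rfl⟩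
    omega
  have hset : {Z : Set (Projectivization F ((Fin 2 ⊕ Fin 2) → F)) |
      ∃ H : Matrix (Fin 2 ⊕ Fin 2) (Fin 2 ⊕ Fin 2) F,
        (∃ Q : Matrix (Fin 2 ⊕ Fin 2) (Fin 2 ⊕ Fin 2) F, IsUnit Q.det ∧
          H = Q * Matrix.fromBlocks 0 1 1 0 * Qᵀ) ∧
        Z = {P : Projectivization F ((Fin 2 ⊕ Fin 2) → F) |
          P.rep ⬝ᵥ H.mulVec P.rep = 0}} = Set.range (zs (F := F)) := by
    ext Z
    constructor
    · rintro ⟨_, ⟨Q, hQ, rfl⟩, rfl⟩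
      obtain ⟨U, rfl⟩ := (Matrix.isUnit_iff_isUnit_det Q).mpr hQ
      exact ⟨U, rfl⟩
    · rintro ⟨U, rfl⟩
      exact ⟨_, ⟨U.1, (Matrix.isUnit_iff_isUnit_det _).mp U.isUnit, rfl⟩, rfl⟩
  rw [hset]
  have hc := card_fib (zs (F := F)) _ (zs_fib h2)
  rw [card_GO h2 q hq, card_GL4 q hq] at hc
  have hq1 : 1 < q := hq ▸ Fintype.one_lt_card
  generalize (Set.range (zs (F := F))).ncard = N at *
  obtain ⟨r, rfl⟩ : ∃ r, q = r + 1 := ⟨q - 1, by omega⟩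
  have hr : 0 < r := by omega
  have p1 : (r+1)^4 - 1 = r * (r+2) * ((r+1)^2+1) := Nat.sub_eq_of_eq_add (by ring)
  have p2 : (r+1)^4 - (r+1) = (r+1) * r * (r^2+3*r+3) := Nat.sub_eq_of_eq_add (by ring)
  have p3 : (r+1)^4 - (r+1)^2 = (r+1)^2 * r * (r+2) := Nat.sub_eq_of_eq_add (by ring)
  have p4 : (r+1)^4 - (r+1)^3 = (r+1)^3 * r := Nat.sub_eq_of_eq_add (by ring)
  have p5 : (r+1)^3 - 1 = r * (r^2+3*r+3) := Nat.sub_eq_of_eq_add (by ring)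
  rw [p1, p2, p3, p4, Nat.add_sub_cancel] at hc
  rw [p5]
  have hpos : 0 < r^3 * (r+1)^2 * (r+2)^2 := by positivity
  apply Nat.eq_of_mul_eq_mul_left hpos
  linear_combination -hc
end

section
/- Let A be the adjacency matrix of a strongly regular graph with eigenvalues k, u_1, u_2 of multiplicities 1, f_1, f_2, let N = A + bJ + cI for scalars b,c, and let p be a prime. If none of the eigenvalues θ_0 = k + bv + c, θ_1 = u_1 + c, θ_2 = u_2 + c is ≡ 0 (mod p) (as algebraic integers reduced mod p), then rank_p(N) = v; if exactly one θ_i ≡ 0 (mod p), then rank_p(N) = v - m_i where m_i is its multiplicity. -/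
open Matrix Polynomial

lemma aux_pow_eq_zero {V : Type} [Fintype V] [DecidableEq V] (m : ℕ) :
    ∀ (M : Matrix V V ℤ), Mᵀ = M → M ^ (2 ^ m) = 0 → M = 0 := by
  induction m with
  | zero => intro M _ h; simpa using h
  | succ m ih =>
    intro M hM h
    have h2 : M * M = 0 := by
      apply ih (M * M)
      · rw [transpose_mul, hM]
      · rw [← pow_two, ← pow_mul, ← pow_succ']; exact h
    have h3 : Mᴴ * M = 0 := by
      rw [conjTranspose_eq_transpose_of_trivial, hM, h2]
    exact conjTranspose_mul_self_eq_zero.mp h3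

lemma aux_minpoly {V : Type} [Fintype V] [DecidableEq V] (B : Matrix V V ℤ) (hB : Bᵀ = B)
    (t₀ t₁ t₂ : ℤ) (f₁ f₂ : ℕ)
    (h : B.charpoly = (X - C t₀) * (X - C t₁) ^ f₁ * (X - C t₂) ^ f₂) :
    aeval B ((X - C t₀) * (X - C t₁) * (X - C t₂)) = 0 := by
  apply aux_pow_eq_zero (1 + f₁ + f₂)
  · simp only [map_mul, map_sub, aeval_X, aeval_C, transpose_mul, transpose_sub, hB,
      Algebra.algebraMap_eq_smul_one, transpose_smul, transpose_one]
    simp only [mul_sub, sub_mul, mul_smul_comm, smul_mul_assoc, mul_one, one_mul, smul_sub,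
      mul_assoc, smul_smul]
    module
  · rw [← map_pow]
    have hd : B.charpoly ∣ ((X - C t₀) * (X - C t₁) * (X - C t₂)) ^ (2 ^ (1 + f₁ + f₂)) := by
      have : 1 + f₁ + f₂ ≤ 2 ^ (1 + f₁ + f₂) := Nat.lt_two_pow_self.le
      rw [h, mul_pow, mul_pow]
      refine mul_dvd_mul (mul_dvd_mul ?_ ?_) ?_
      · exact dvd_pow_self _ (by positivity)
      · exact pow_dvd_pow _ (by omega)
      · exact pow_dvd_pow _ (by omega)
    obtain ⟨q, hq⟩ := hd
    rw [hq, map_mul, aeval_self_charpoly, zero_mul]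

lemma aux_rank {V : Type} [Fintype V] [DecidableEq V] {F : Type} [Field F] (M : Matrix V V F)
    (s : F) (m : ℕ) (q r : F[X]) (hr : r.eval s ≠ 0) (hq : q.eval s ≠ 0)
    (hc : M.charpoly = (X - C s) ^ m * r) (ha : aeval M ((X - C s) * q) = 0) :
    (M - s • (1 : Matrix V V F)).rank = Fintype.card V - m := by
  have hm : M.charpoly.rootMultiplicity s = m := by
    rw [hc, rootMultiplicity_mul (by rw [← hc]; exact M.charpoly_monic.ne_zero),
      rootMultiplicity_X_sub_C_pow, rootMultiplicity_eq_zero (by simpa using hr), add_zero]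
  have hf := LinearMap.finrank_maxGenEigenspace_eq (Matrix.toLin' M) s
  rw [charpoly_toLin', hm] at hf
  have hE : Module.End.maxGenEigenspace (Matrix.toLin' M) s = LinearMap.ker (toLin' (M - s • 1)) := by
    apply le_antisymm
    · intro x hx
      rw [Module.End.mem_maxGenEigenspace] at hx
      obtain ⟨j, hj⟩ := hx
      have e1 : (toLin' M - s • 1) = aeval (toLin' M) (X - C s) := by
        simp [Algebra.algebraMap_eq_smul_one]
      have e2 : toLin' (M - s • 1) = aeval (toLin' M) (X - C s) := by
        rw [← e1]; simp; rfl
      have ha' : aeval (toLin' M) ((X - C s) * q) = 0 := by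
        have := congrArg (toLinAlgEquiv' (R := F) (n := V)) ha
        rw [← Polynomial.aeval_algHom_apply] at this
        rw [map_zero] at this; exact this
      rw [LinearMap.mem_ker, e2]
      rw [e1, ← map_pow] at hj
      have hcop : IsCoprime ((X - C s) ^ j) q := by
        apply IsCoprime.pow_left
        rw [(irreducible_X_sub_C s).coprime_iff_not_dvd, dvd_iff_isRoot]
        exact hq
      obtain ⟨a, b, hab⟩ := hcop
      have : (X - C s) = (X - C s) * a * (X - C s) ^ j + b * ((X - C s) * q) := by
        linear_combination (-(X - C s)) * hab
      rw [this, map_add, map_mul _ b, ha', map_mul, mul_zero, add_zero, Module.End.mul_apply, hj, map_zero]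
    · intro x hx
      rw [Module.End.mem_maxGenEigenspace]
      refine ⟨1, ?_⟩
      simpa using hx
  have := LinearMap.finrank_range_add_finrank_ker (toLin' (M - s • 1))
  rw [← hE, hf, Module.finrank_fintype_fun_eq_card] at this
  have hrk : (M - s • (1 : Matrix V V F)).rank
    = Module.finrank F (LinearMap.range (toLin' (M - s • 1))) := rfl
  omega

lemma aux_charpoly {V : Type} [Fintype V] [DecidableEq V] (A : Matrix V V ℤ) (k b : ℤ)
    (hA : A *ᵥ (fun _ => 1) = fun _ => k) :
    (X - C k) * (A + b • Matrix.of (fun _ _ => (1 : ℤ))).charpoly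
      = (X - C (k + b * Fintype.card V)) * A.charpoly := by
  rcases isEmpty_or_nonempty V with hV | hV
  · simp
  set J : Matrix V V ℤ := Matrix.of (fun _ _ => (1 : ℤ)) with hJ
  have hAJ : A * J = k • J := by
    ext i j
    have := congrFun hA i
    simpa [Matrix.mul_apply, mulVec, dotProduct, hJ] using this
  have hvec : vecMulVec (fun _ => b) (fun _ => 1) = b • J := by
    ext i j; simp [vecMulVec, hJ]
  have hcj := charpoly_vecMulVec (R := ℤ) (n := V) (fun _ => b) (fun _ => 1)
  rw [hvec] at hcj
  have hmat : (X - C k : ℤ[X]) • charmatrix (A + b • J)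
      = charmatrix A * ((X - C k : ℤ[X]) • 1 - (b • J).map C) := by
    have h1 : (A.map C : Matrix V V ℤ[X]) * J.map C = (C k : ℤ[X]) • J.map C := by
      rw [← Matrix.map_mul, hAJ]; ext i j; simp [-zsmul_eq_mul]
    have h2 : (b • J).map C = (C b : ℤ[X]) • J.map C := by
      ext i j; simp [-zsmul_eq_mul]
    have h3 : (A + b • J).map C = A.map C + (b • J).map C := by
      ext i j; simp [-zsmul_eq_mul]
    have h4 : (scalar V) (X : ℤ[X]) = (X : ℤ[X]) • 1 := by
      simp [smul_one_eq_diagonal]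
    simp only [charmatrix, RingHom.mapMatrix_apply, h3, h2, h4]
    simp only [mul_sub, sub_mul, mul_smul_comm, smul_mul_assoc, mul_one, one_mul, h1]
    module
  have hdet := congrArg Matrix.det hmat
  rw [det_smul, det_mul] at hdet
  have hshift : ((X - C k : ℤ[X]) • (1 : Matrix V V ℤ[X]) - (b • J).map C).det
      = (b • J).charpoly.comp (X - C k) := by
    rw [charpoly, ← Polynomial.coe_compRingHom_apply, RingHom.map_det]
    congr 1
    ext i j
    by_cases hij : i = j
    · subst hij; simp [-zsmul_eq_mul]
    · simp [-zsmul_eq_mul, hij]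
  rw [hshift, hcj] at hdet
  have hn : Fintype.card V = (Fintype.card V - 1) + 1 := by
    have := Fintype.card_pos (α := V); omega
  have hne : (X - C k : ℤ[X]) ^ (Fintype.card V - 1) ≠ 0 := pow_ne_zero _ (X_sub_C_ne_zero k)
  apply mul_left_cancel₀ hne
  have hpow : (X - C k : ℤ[X]) ^ Fintype.card V = (X - C k) ^ (Fintype.card V - 1) * (X - C k) := by
    rw [← pow_succ, ← hn]
  have hdot : (fun _ : V => b) ⬝ᵥ (fun _ => 1) = b * Fintype.card V := by
    simp [dotProduct, mul_comm]
  rw [hdot] at hdet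
  simp only [sub_comp, pow_comp, X_comp, smul_eq_C_mul, mul_comp, C_comp] at hdet
  change (X - C k) ^ Fintype.card V * (A + b • J).charpoly = A.charpoly * _ at hdet
  rw [hpow] at hdet
  simp only [C_add]
  linear_combination hdet

/-- Brouwer's p-rank lemma (the first two cases): if A is the adjacency matrix of a
strongly regular graph with eigenvalues k,u₁,u₂ of multiplicities 1,f₁,f₂ and
N = A + bJ + cI, θ₀ = k+bv+c, θ₁ = u₁+c, θ₂ = u₂+c, then rank_p(N) = v when no θᵢ
is divisible by p, and rank_p(N) = v - mᵢ when exactly one θᵢ is divisible by p. -/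
theorem stmt_16 {V : Type} [Fintype V] [DecidableEq V]
    (G : SimpleGraph V) [DecidableRel G.Adj]
    (v k lam mu : ℕ) (hv : Fintype.card V = v)
    (hsrg : G.IsSRGWith v k lam mu)
    (u₁ u₂ : ℤ) (f₁ f₂ : ℕ)
    (hchar : (G.adjMatrix ℤ).charpoly
      = (X - C (k : ℤ)) * (X - C u₁) ^ f₁ * (X - C u₂) ^ f₂)
    (b c : ℤ) (p : ℕ) (hp : p.Prime)
    (N : Matrix V V ℤ)
    (hN : N = G.adjMatrix ℤ + b • Matrix.of (fun _ _ => (1 : ℤ)) + c • (1 : Matrix V V ℤ)) :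
    (¬ (p : ℤ) ∣ ((k : ℤ) + b * v + c) → ¬ (p : ℤ) ∣ (u₁ + c) → ¬ (p : ℤ) ∣ (u₂ + c) →
      (N.map (Int.cast : ℤ → ZMod p)).rank = v) ∧
    ((p : ℤ) ∣ ((k : ℤ) + b * v + c) → ¬ (p : ℤ) ∣ (u₁ + c) → ¬ (p : ℤ) ∣ (u₂ + c) →
      (N.map (Int.cast : ℤ → ZMod p)).rank = v - 1) ∧
    (¬ (p : ℤ) ∣ ((k : ℤ) + b * v + c) → (p : ℤ) ∣ (u₁ + c) → ¬ (p : ℤ) ∣ (u₂ + c) →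
      (N.map (Int.cast : ℤ → ZMod p)).rank = v - f₁) ∧
    (¬ (p : ℤ) ∣ ((k : ℤ) + b * v + c) → ¬ (p : ℤ) ∣ (u₁ + c) → (p : ℤ) ∣ (u₂ + c) →
      (N.map (Int.cast : ℤ → ZMod p)).rank = v - f₂) := by
  have : Fact p.Prime := ⟨hp⟩
  set B : Matrix V V ℤ := G.adjMatrix ℤ + b • Matrix.of (fun _ _ => (1 : ℤ)) with hB
  have hBt : Bᵀ = B := by
    ext i j
    simp [hB, SimpleGraph.adjMatrix_apply, G.adj_comm]
  have hA : G.adjMatrix ℤ *ᵥ (fun _ => 1) = fun _ => (k : ℤ) := by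
    ext i
    have := SimpleGraph.adjMatrix_mulVec_const_apply_of_regular (α := ℤ) (a := 1) hsrg.regular
      (v := i)
    simpa [Function.const_def] using this
  have hcB : B.charpoly
      = (X - C ((k : ℤ) + b * v)) * (X - C u₁) ^ f₁ * (X - C u₂) ^ f₂ := by
    have h := aux_charpoly (G.adjMatrix ℤ) k b hA
    apply mul_left_cancel₀ (X_sub_C_ne_zero (k : ℤ))
    rw [← hB, hchar, hv] at h
    rw [h]; ring
  have haB := aux_minpoly B hBt _ _ _ _ _ hcB
  let φ : ℤ →+* ZMod p := Int.castRingHom (ZMod p)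
  have hNM : N.map (Int.cast : ℤ → ZMod p) = φ.mapMatrix B - (-(c : ZMod p)) • 1 := by
    rw [hN]
    ext i j
    by_cases hij : i = j
    · subst hij; simp [φ, -zsmul_eq_mul, -zsmul_one]
    · simp [hij, φ, -zsmul_eq_mul, -zsmul_one]
  have hcM : (φ.mapMatrix B).charpoly = (X - C (φ ((k : ℤ) + b * v))) * (X - C (φ u₁)) ^ f₁
      * (X - C (φ u₂)) ^ f₂ := by
    rw [RingHom.mapMatrix_apply, charpoly_map, hcB]
    simp [Polynomial.map_mul, Polynomial.map_pow]
  have haM : aeval (φ.mapMatrix B)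
      ((X - C (φ ((k : ℤ) + b * v))) * (X - C (φ u₁)) * (X - C (φ u₂))) = 0 := by
    have h := congrArg φ.mapMatrix haB
    simp only [map_mul, map_sub, aeval_X, aeval_C, map_zero,
      Algebra.algebraMap_eq_smul_one] at h ⊢
    have hs : ∀ t : ℤ, φ.mapMatrix (t • (1 : Matrix V V ℤ)) = φ t • 1 := by
      intro t
      ext i j
      by_cases hij : i = j
      · subst hij; simp [-zsmul_eq_mul, -zsmul_one]
      · simp [hij, -zsmul_eq_mul, -zsmul_one]
    simpa only [hs] using h
  have hdvd : ∀ t : ℤ, (p : ℤ) ∣ t + c ↔ φ t = -(c : ZMod p) := by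
    intro t
    rw [← ZMod.intCast_zmod_eq_zero_iff_dvd, eq_neg_iff_add_eq_zero]
    simp [φ]
  rw [hNM]
  simp only [hdvd, ← hv] at hcM haM ⊢
  generalize φ.mapMatrix B = M at *
  generalize φ u₁ = s₁ at *
  generalize φ u₂ = s₂ at *
  generalize φ (↑k + b * ↑(Fintype.card V)) = s₀ at *
  generalize -(c : ZMod p) = s at *
  refine ⟨fun h0 h1 h2 => ?_, fun h0 h1 h2 => ?_, fun h0 h1 h2 => ?_, fun h0 h1 h2 => ?_⟩
  · rw [← Nat.sub_zero (Fintype.card V)]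
    refine aux_rank M s 0 ((X - C s₀) * (X - C s₁) * (X - C s₂))
      ((X - C s₀) * (X - C s₁) ^ f₁ * (X - C s₂) ^ f₂) ?_ ?_ (by rw [hcM]; ring)
      (by rw [map_mul, haM, mul_zero])
    · simp [sub_eq_zero, Ne.symm h0, Ne.symm h1, Ne.symm h2]
    · simp [sub_eq_zero, Ne.symm h0, Ne.symm h1, Ne.symm h2]
  · subst h0
    refine aux_rank M s₀ 1 ((X - C s₁) * (X - C s₂))
      ((X - C s₁) ^ f₁ * (X - C s₂) ^ f₂) ?_ ?_ (by rw [hcM]; ring)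
      (by rw [← haM]; congr 1; ring)
    · simp [sub_eq_zero, Ne.symm h1, Ne.symm h2]
    · simp [sub_eq_zero, Ne.symm h1, Ne.symm h2]
  · subst h1
    refine aux_rank M s₁ f₁ ((X - C s₀) * (X - C s₂))
      ((X - C s₀) * (X - C s₂) ^ f₂) ?_ ?_ (by rw [hcM]; ring)
      (by rw [← haM]; congr 1; ring)
    · simp [sub_eq_zero, Ne.symm h0, Ne.symm h2]
    · simp [sub_eq_zero, Ne.symm h0, Ne.symm h2]
  · subst h2
    refine aux_rank M s₂ f₂ ((X - C s₀) * (X - C s₁))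
      ((X - C s₀) * (X - C s₁) ^ f₁) ?_ ?_ (by rw [hcM]; ring)
      (by rw [← haM]; congr 1; ring)
    · simp [sub_eq_zero, Ne.symm h0, Ne.symm h1]
    · simp [sub_eq_zero, Ne.symm h0, Ne.symm h1]
end
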